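/- arXiv:1309.5082 — 2 statements merged into one kernel-verified Lean document; each statement's English description precedes it below -/
import Mathlib

section
/- Let R = k[x_0,…,x_n] be a polynomial ring over a field k, let I ⊆ R be a monomial ideal, and let 𝒬 be the symbolic polyhedron of I. Then for all positive integers m, α(I^{(m)}) ≥ m·α(𝒬), and equality α(I^{(m)}) = m·α(𝒬) holds for infinitely many m. -/
open MvPolynomial Pointwise

noncomputable section

/-- The contraction to `R` of the extension of `I ^ m` to the localization of `R` at the
prime ideal `P`, i.e. `R ∩ I^m R_P`. -/
def contractedPower {R : Type*} [CommRing R] (I : Ideal R) (m : ℕ)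
    (P : Ideal R) (hP : P.IsPrime) : Ideal R :=
  letI := hP
  (Ideal.map (algebraMap R (Localization.AtPrime P)) (I ^ m)).comap
    (algebraMap R (Localization.AtPrime P))

/-- `Q_{⊆ P} = R ∩ I R_P`, the contraction to `R` of the extension of `I` to `R_P`. -/
def Qsub {R : Type*} [CommRing R] (I P : Ideal R) (hP : P.IsPrime) : Ideal R :=
  letI := hP
  (Ideal.map (algebraMap R (Localization.AtPrime P)) I).comap
    (algebraMap R (Localization.AtPrime P))

/-- The `m`-th symbolic power `I^{(m)} = ⋂_{P ∈ Ass(I)} (R ∩ I^m R_P)`. -/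
def symbolicPower {R : Type*} [CommRing R] (I : Ideal R) (m : ℕ) : Ideal R :=
  ⨅ P : {P : Ideal R // P ∈ associatedPrimes R (R ⧸ I)},
    contractedPower I m P.1 P.2.isPrime

/-- The set of associated primes of `I` that are maximal with respect to inclusion. -/
def maxAss {R : Type*} [CommRing R] (I : Ideal R) : Set (Ideal R) :=
  {P | P ∈ associatedPrimes R (R ⧸ I) ∧
    ∀ P' ∈ associatedPrimes R (R ⧸ I), P ≤ P' → P = P'}

/-- A monomial ideal: an ideal generated by monomials. -/
def IsMonomialIdeal {k : Type*} [Field k] {n : ℕ}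
    (I : Ideal (MvPolynomial (Fin (n + 1)) k)) : Prop :=
  ∃ S : Set (Fin (n + 1) →₀ ℕ),
    I = Ideal.span ((fun a => (monomial a (1 : k) : MvPolynomial (Fin (n + 1)) k)) '' S)

/-- A square-free monomial ideal: an ideal generated by square-free monomials. -/
def IsSquarefreeMonomialIdeal {k : Type*} [Field k] {n : ℕ}
    (I : Ideal (MvPolynomial (Fin (n + 1)) k)) : Prop :=
  ∃ S : Set (Fin (n + 1) →₀ ℕ), (∀ a ∈ S, ∀ i, a i ≤ 1) ∧
    I = Ideal.span ((fun a => (monomial a (1 : k) : MvPolynomial (Fin (n + 1)) k)) '' S)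

/-- The height of a prime ideal. -/
def primeHeight {R : Type*} [CommRing R] (P : Ideal R) (hP : P.IsPrime) : ℕ∞ :=
  Order.height (⟨P, hP⟩ : PrimeSpectrum R)

/-- `e` is the big-height of `I`: the maximum of the heights of the associated primes of `I`. -/
def IsBigHeight {R : Type*} [CommRing R] (I : Ideal R) (e : ℕ) : Prop :=
  (∀ P, ∀ h : P ∈ associatedPrimes R (R ⧸ I), primeHeight P h.isPrime ≤ (e : ℕ∞)) ∧
    ∃ P, ∃ h : P ∈ associatedPrimes R (R ⧸ I), primeHeight P h.isPrime = (e : ℕ∞)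

/-- The irrelevant maximal ideal `𝔪 = (x_0, …, x_n)`. -/
def mId (k : Type*) [Field k] (n : ℕ) : Ideal (MvPolynomial (Fin (n + 1)) k) :=
  Ideal.span (Set.range X)

/-- The exponent vector of a monomial, viewed as a point of `ℝ^{n+1}`. -/
def expVec {n : ℕ} (a : Fin (n + 1) →₀ ℕ) : Fin (n + 1) → ℝ := fun i => (a i : ℝ)

/-- `L(J)`: the set of exponent vectors of the monomials lying in `J`. -/
def latticePoints {k : Type*} [Field k] {n : ℕ}
    (J : Ideal (MvPolynomial (Fin (n + 1)) k)) : Set (Fin (n + 1) → ℝ) :=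
  {v | ∃ a : Fin (n + 1) →₀ ℕ, monomial a (1 : k) ∈ J ∧ v = expVec a}

/-- The exponent vectors of the minimal monomial generators of a monomial ideal. -/
def minGens {k : Type*} [Field k] {n : ℕ}
    (J : Ideal (MvPolynomial (Fin (n + 1)) k)) : Set (Fin (n + 1) →₀ ℕ) :=
  {a | monomial a (1 : k) ∈ J ∧
    ∀ b : Fin (n + 1) →₀ ℕ, monomial b (1 : k) ∈ J → b ≤ a → b = a}

/-- The symbolic polyhedron `𝒬 = ⋂_{P ∈ maxAss(I)} conv(L(Q_{⊆P}))`. -/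
def symbolicPolyhedron {k : Type*} [Field k] {n : ℕ}
    (I : Ideal (MvPolynomial (Fin (n + 1)) k)) : Set (Fin (n + 1) → ℝ) :=
  ⋂ P : {P : Ideal (MvPolynomial (Fin (n + 1)) k) // P ∈ maxAss I},
    convexHull ℝ (latticePoints (Qsub I P.1 P.2.1.isPrime))

/-- `α(J)`: the least degree of a nonzero (homogeneous) element of `J`. -/
def alphaI {k : Type*} [Field k] {n : ℕ}
    (J : Ideal (MvPolynomial (Fin (n + 1)) k)) : ℕ :=
  sInf {d | ∃ f ∈ J, f ≠ 0 ∧ MvPolynomial.IsHomogeneous f d}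

/-- `β(J)`: the largest degree of a minimal generator of the monomial ideal `J`. -/
def betaI {k : Type*} [Field k] {n : ℕ}
    (J : Ideal (MvPolynomial (Fin (n + 1)) k)) : ℕ :=
  sSup {d | ∃ a ∈ minGens J, ∑ i, a i = d}

/-- `α(𝒫) = inf { a_0 + ⋯ + a_n : a ∈ 𝒫 }` for a subset `𝒫 ⊆ ℝ^{n+1}`. -/
def alphaSet {n : ℕ} (P : Set (Fin (n + 1) → ℝ)) : ℝ :=
  sInf ((fun v => ∑ i, v i) '' P)

/-- The set of all conical (nonnegative) combinations of elements of `S`. -/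
def conicalHull {E : Type*} [AddCommMonoid E] [Module ℝ E] (S : Set E) : Set E :=
  {x | ∃ (t : Finset E) (c : E → ℝ), ↑t ⊆ S ∧ (∀ y, 0 ≤ c y) ∧ x = ∑ y ∈ t, c y • y}

/-- The staircase of a monomial ideal `J`. -/
def stairs {k : Type*} [Field k] {n : ℕ}
    (J : Ideal (MvPolynomial (Fin (n + 1)) k)) : Set (Fin (n + 1) → ℝ) :=
  {v | (∀ i, 0 ≤ v i) ∧
    ∃ a : Fin (n + 1) →₀ ℕ, monomial a (1 : k) ∈ J ∧ ∀ i, (a i : ℝ) ≤ v i}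

end

/-- A feasible point of a standard form linear program whose cost is nonnegative can be replaced,
without increasing the cost, by one that is the only solution with its support. -/
theorem exists_basic_feasible {ι κ : Type*} [Fintype ι] (M : κ → ι → ℝ) (b : κ → ℝ) (c : ι → ℝ)
    (hc : ∀ i, 0 ≤ c i) (z : ι → ℝ) (hz : ∀ i, 0 ≤ z i) (hMz : ∀ r, ∑ i, M r i * z i = b r) :
    ∃ y : ι → ℝ, (∀ i, 0 ≤ y i) ∧ (∀ r, ∑ i, M r i * y i = b r) ∧
      (∀ x : ι → ℝ, (∀ r, ∑ i, M r i * x i = b r) → (∀ i, y i = 0 → x i = 0) → x = y) ∧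
      ∑ i, c i * y i ≤ ∑ i, c i * z i := by
  classical
  induction hN : (Finset.univ.filter fun i => z i ≠ 0).card using Nat.strong_induction_on
    generalizing z with
  | _ N ih =>
  by_cases hb : ∀ x : ι → ℝ, (∀ r, ∑ i, M r i * x i = b r) → (∀ i, z i = 0 → x i = 0) → x = z
  · exact ⟨z, hz, hMz, hb, le_rfl⟩
  push Not at hb
  obtain ⟨x, hx, hxz, hne⟩ := hb
  obtain ⟨d, hMd, hdz, hcd, i₀, hi₀⟩ : ∃ d : ι → ℝ, (∀ r, ∑ i, M r i * d i = 0) ∧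
      (∀ i, z i = 0 → d i = 0) ∧ ∑ i, c i * d i ≤ 0 ∧ ∃ i, d i < 0 := by
    have key : ∀ d : ι → ℝ, (∀ r, ∑ i, M r i * d i = 0) → (∀ i, z i = 0 → d i = 0) → d ≠ 0 →
        ∑ i, c i * d i ≤ 0 → ∃ d : ι → ℝ, (∀ r, ∑ i, M r i * d i = 0) ∧
      (∀ i, z i = 0 → d i = 0) ∧ ∑ i, c i * d i ≤ 0 ∧ ∃ i, d i < 0 := by
      intro d h1 h2 h3 h4
      by_cases h5 : ∃ i, d i < 0
      · exact ⟨d, h1, h2, h4, h5⟩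
      push Not at h5
      refine ⟨-d, fun r => by simp [h1 r], fun i hi => by simp [h2 i hi], ?_, ?_⟩
      · simp only [Pi.neg_apply, mul_neg, Finset.sum_neg_distrib, neg_nonpos]
        exact Finset.sum_nonneg fun i _ => mul_nonneg (hc i) (h5 i)
      · obtain ⟨i, hi⟩ := Function.ne_iff.1 h3
        exact ⟨i, neg_lt_zero.2 (lt_of_le_of_ne (h5 i) (Ne.symm hi))⟩
    have h1 : ∀ r, ∑ i, M r i * (x - z) i = 0 := fun r => by
      simp [mul_sub, Finset.sum_sub_distrib, hx r, hMz r]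
    have h2 : ∀ i, z i = 0 → (x - z) i = 0 := fun i hi => by simp [hi, hxz i hi]
    rcases le_total (∑ i, c i * (x - z) i) 0 with h | h
    · exact key (x - z) h1 h2 (sub_ne_zero.2 hne) h
    · refine key (-(x - z)) (fun r => ?_) (fun i hi => ?_) (neg_ne_zero.2 (sub_ne_zero.2 hne)) ?_
      · simpa only [Pi.neg_apply, mul_neg, Finset.sum_neg_distrib, neg_eq_zero] using h1 r
      · simpa only [Pi.neg_apply, neg_eq_zero] using h2 i hi
      · simpa only [Pi.neg_apply, mul_neg, Finset.sum_neg_distrib, neg_nonpos] using h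
  obtain ⟨j, hj, hmin⟩ := Finset.exists_min_image (Finset.univ.filter fun i => d i < 0)
    (fun i => z i / (-d i)) ⟨i₀, by simpa using hi₀⟩
  have hj : d j < 0 := by simpa using hj
  set t := z j / (-d j) with ht
  have ht0 : 0 ≤ t := div_nonneg (hz j) (by linarith)
  have hw : ∀ i, 0 ≤ (z + t • d) i := by
    intro i
    simp only [Pi.add_apply, Pi.smul_apply, smul_eq_mul]
    rcases lt_or_ge (d i) 0 with h | h
    · have h1 := hmin i (by simpa using h)
      rw [le_div_iff₀ (by linarith)] at h1
      linarith
    · exact add_nonneg (hz i) (mul_nonneg ht0 h)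
  have hwj : (z + t • d) j = 0 := by
    simp only [Pi.add_apply, Pi.smul_apply, smul_eq_mul, ht, div_neg, neg_mul,
      div_mul_cancel₀ _ hj.ne, add_neg_cancel]
  obtain ⟨y, h1, h2, h3, h4⟩ := ih _ (by
    rw [← hN]
    apply Finset.card_lt_card
    rw [Finset.ssubset_iff_of_subset]
    · refine ⟨j, ?_, by simpa using hwj⟩
      simp only [Finset.mem_filter, Finset.mem_univ, true_and]
      intro h
      exact hj.ne (hdz j h)
    · intro i
      simp only [Finset.mem_filter, Finset.mem_univ, true_and]
      intro h h'
      exact h (by simp [h', hdz i h'])) (z + t • d) hw (fun r => by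
        simp only [Pi.add_apply, Pi.smul_apply, smul_eq_mul, mul_add, Finset.sum_add_distrib,
          hMz r, mul_left_comm _ t, ← Finset.mul_sum, hMd r, mul_zero, add_zero]) rfl
  refine ⟨y, h1, h2, h3, h4.trans ?_⟩
  simp only [Pi.add_apply, Pi.smul_apply, smul_eq_mul, mul_add, Finset.sum_add_distrib,
    mul_left_comm _ t, ← Finset.mul_sum]
  nlinarith

/-- If a linear system with rational coefficients has exactly one real solution with given zeros,
then this solution is rational. -/
theorem exists_rat_of_unique_solution {ι κ : Type*} [Fintype ι] (M : κ → ι → ℚ) (b : κ → ℚ)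
    (y : ι → ℝ) (hy : ∀ r, ∑ i, (M r i : ℝ) * y i = b r)
    (huniq : ∀ x : ι → ℝ, (∀ r, ∑ i, (M r i : ℝ) * x i = b r) →
      (∀ i, y i = 0 → x i = 0) → x = y) :
    ∃ q : ι → ℚ, ∀ i, (q i : ℝ) = y i := by
  obtain ⟨p, hp⟩ := LinearMap.exists_leftInverse_of_injective (Algebra.linearMap ℚ ℝ)
    (LinearMap.ker_eq_bot.2 (algebraMap ℚ ℝ).injective)
  have hpq : ∀ q : ℚ, p (q : ℝ) = q := fun q => by simpa using LinearMap.congr_fun hp q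
  refine ⟨fun i => p (y i), fun i => congr_fun (huniq (fun i => (p (y i) : ℝ)) ?_ ?_) i⟩
  · intro r
    have h := congr_arg p (hy r)
    rw [map_sum, hpq] at h
    have h' : ∀ i, p ((M r i : ℝ) * y i) = M r i * p (y i) := fun i => by
      rw [← smul_eq_mul (M r i), ← map_smul, Rat.smul_def]
    simp only [h'] at h
    exact_mod_cast h
  · intro i hi
    simp [hi]

/-- A feasible standard form linear program with rational constraints and nonnegative cost has a
rational optimal solution. -/
theorem exists_rat_optimal {ι κ : Type*} [Fintype ι] (M : κ → ι → ℚ) (b : κ → ℚ) (c : ι → ℝ)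
    (hc : ∀ i, 0 ≤ c i)
    (hne : ∃ z : ι → ℝ, (∀ i, 0 ≤ z i) ∧ ∀ r, ∑ i, (M r i : ℝ) * z i = b r) :
    ∃ q : ι → ℚ, (∀ i, 0 ≤ q i) ∧ (∀ r, ∑ i, M r i * q i = b r) ∧
      ∀ z : ι → ℝ, (∀ i, 0 ≤ z i) → (∀ r, ∑ i, (M r i : ℝ) * z i = b r) →
        ∑ i, c i * (q i : ℝ) ≤ ∑ i, c i * z i := by
  let B : Set (ι → ℝ) := {y | (∀ i, 0 ≤ y i) ∧ (∀ r, ∑ i, (M r i : ℝ) * y i = b r) ∧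
    ∀ x : ι → ℝ, (∀ r, ∑ i, (M r i : ℝ) * x i = b r) → (∀ i, y i = 0 → x i = 0) → x = y}
  have hB : ∀ z : ι → ℝ, (∀ i, 0 ≤ z i) → (∀ r, ∑ i, (M r i : ℝ) * z i = b r) →
      ∃ y ∈ B, ∑ i, c i * y i ≤ ∑ i, c i * z i := fun z hz hMz => by
    obtain ⟨y, h1, h2, h3, h4⟩ :=
      exists_basic_feasible (fun r i => (M r i : ℝ)) (fun r => (b r : ℝ)) c hc z hz hMz
    exact ⟨y, ⟨h1, h2, h3⟩, h4⟩
  have hfin : B.Finite := by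
    refine Set.Finite.of_finite_image (f := Function.support) (Set.toFinite _) ?_
    intro y hy y' hy' h
    refine hy'.2.2 y hy.2.1 fun i hi => ?_
    by_contra h0
    have : i ∈ Function.support y' := h ▸ h0
    exact this hi
  obtain ⟨z, hz, hMz⟩ := hne
  obtain ⟨y₀, hy₀, -⟩ := hB z hz hMz
  obtain ⟨y, hy, hmin⟩ := Set.exists_min_image B (fun y => ∑ i, c i * y i) hfin ⟨y₀, hy₀⟩
  obtain ⟨q, hq⟩ := exists_rat_of_unique_solution M b y hy.2.1 hy.2.2
  refine ⟨q, fun i => ?_, fun r => ?_, fun z hz hMz => ?_⟩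
  · have := hy.1 i
    rw [← hq] at this
    exact_mod_cast this
  · have := hy.2.1 r
    simp only [← hq] at this
    exact_mod_cast this
  · obtain ⟨y', hy', hle⟩ := hB z hz hMz
    simp only [hq]
    exact (hmin y' hy').trans hle

/-- The set of sums of `m` elements of `T`. -/
def sumsOf {M : Type*} [AddMonoid M] (T : Set M) : ℕ → Set M
  | 0 => {0}
  | m + 1 => sumsOf T m + T

/-- The variables contained in an ideal. -/
def idealVars {σ k : Type*} [CommSemiring k] (P : Ideal (MvPolynomial σ k)) : Set σ :=
  {i | X i ∈ P}

theorem span_monomial_pow_le {σ k : Type*} [CommSemiring k] (T : Set (σ →₀ ℕ)) (m : ℕ) :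
    (Ideal.span ((fun a => (monomial a (1 : k) : MvPolynomial σ k)) '' T)) ^ m ≤
      Ideal.span ((fun a => (monomial a (1 : k) : MvPolynomial σ k)) '' sumsOf T m) := by
  induction m with
  | zero => simp [sumsOf, Ideal.one_eq_top]
  | succ m ih =>
    rw [pow_succ]
    refine (Ideal.mul_mono_left ih).trans ?_
    rw [Ideal.span_mul_span', Ideal.span_le]
    rintro _ ⟨_, ⟨a, ha, rfl⟩, _, ⟨s, hs, rfl⟩, rfl⟩
    refine Ideal.subset_span ⟨a + s, Set.add_mem_add ha hs, ?_⟩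
    simp [monomial_mul]

open Classical in
/-- Multiplication by a polynomial having a monomial in the variables outside `A` preserves
non-membership in the ideal generated by monomials in the variables of `A`. -/
theorem exists_filter_le_of_mul_mem {σ k : Type*} [CommRing k] [IsDomain k]
    (C : Set (σ →₀ ℕ)) (A : Set σ) (f g : MvPolynomial σ k)
    (hfg : g * f ∈ Ideal.span ((fun a => (monomial a (1 : k) : MvPolynomial σ k)) '' C))
    (hg : ∃ b ∈ g.support, ∀ i ∈ A, b i = 0) :
    ∀ a ∈ f.support, ∃ u ∈ C, u.filter (· ∈ A) ≤ a := by
  by_contra! hcon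
  rw [mul_comm, mem_ideal_span_monomial_image] at hfg
  let δ : (σ →₀ ℕ) → ℕ := fun a => (a.filter (· ∈ A)).degree
  have hδ : ∀ a b, δ (a + b) = δ a + δ b := fun a b => by
    simp only [δ, Finsupp.filter_add, map_add]
  have hδ0 : ∀ b, δ b = 0 ↔ ∀ i ∈ A, b i = 0 := fun b => by
    simp only [δ, Finsupp.degree_eq_zero_iff, Finsupp.filter_eq_zero_iff]
  let bad : Finset (σ →₀ ℕ) := f.support.filter fun a => ∀ u ∈ C, ¬ u.filter (· ∈ A) ≤ a
  have mem_bad : ∀ a, a ∈ bad ↔ a ∈ f.support ∧ ∀ u ∈ C, ¬ u.filter (· ∈ A) ≤ a :=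
    fun a => Finset.mem_filter
  obtain ⟨a₁, ha₁, hmin⟩ := Finset.exists_min_image bad δ <| by
    obtain ⟨a, ha, h⟩ := hcon
    exact ⟨a, (mem_bad a).2 ⟨ha, h⟩⟩
  obtain ⟨b₁, hb₁, hb₁'⟩ := hg
  obtain ⟨a₀, ha₀, b₀, hb₀, huniq⟩ := UniqueSums.uniqueAdd_of_nonempty
    (A := bad.filter fun a => δ a = δ a₁) (B := g.support.filter fun b => δ b = 0)
    ⟨a₁, Finset.mem_filter.2 ⟨ha₁, rfl⟩⟩ ⟨b₁, Finset.mem_filter.2 ⟨hb₁, (hδ0 b₁).2 hb₁'⟩⟩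
  obtain ⟨ha₀, ha₀'⟩ := Finset.mem_filter.1 ha₀
  obtain ⟨hb₀, hb₀'⟩ := Finset.mem_filter.1 hb₀
  obtain ⟨haf, hau⟩ := (mem_bad a₀).1 ha₀
  have hle : ∀ u ∈ C, ¬ u.filter (· ∈ A) ≤ a₀ + b₀ := by
    intro u hu h
    refine hau u hu fun i => ?_
    have hi := h i
    by_cases hiA : i ∈ A
    · simpa [(hδ0 b₀).1 hb₀' i hiA] using hi
    · simp [hiA]
  have hcoeff : coeff (a₀ + b₀) (f * g) = coeff a₀ f * coeff b₀ g := by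
    rw [coeff_mul, Finset.sum_eq_single (a₀, b₀)]
    · rintro ⟨a, b⟩ hab hne
      rw [Finset.HasAntidiagonal.mem_antidiagonal] at hab
      dsimp only at hab ⊢
      by_contra h0
      have haf' : a ∈ f.support := mem_support_iff.2 (left_ne_zero_of_mul h0)
      have hbg' : b ∈ g.support := mem_support_iff.2 (right_ne_zero_of_mul h0)
      have hbad : a ∈ bad := (mem_bad a).2 ⟨haf', fun u hu h =>
        hle u hu (h.trans (hab ▸ le_self_add))⟩
      have h1 := hmin a hbad
      have h2 := hδ a b
      rw [hab, hδ, ha₀', hb₀'] at h2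
      obtain ⟨rfl, rfl⟩ := huniq (Finset.mem_filter.2 ⟨hbad, by omega⟩)
        (Finset.mem_filter.2 ⟨hbg', by omega⟩) hab
      exact hne rfl
    · intro h
      rw [Finset.HasAntidiagonal.mem_antidiagonal] at h
      exact absurd rfl h
  obtain ⟨u, hu, hua⟩ := hfg (a₀ + b₀) <| by
    rw [mem_support_iff, hcoeff]
    exact mul_ne_zero (mem_support_iff.1 haf) (mem_support_iff.1 hb₀)
  refine hle u hu (le_trans (fun i => ?_) hua)
  by_cases hiA : i ∈ A <;> simp [hiA]

theorem mem_contractedPower_iff {R : Type*} [CommRing R] (I : Ideal R) (m : ℕ)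
    (P : Ideal R) (hP : P.IsPrime) (f : R) :
    f ∈ contractedPower I m P hP ↔ ∃ g ∉ P, g * f ∈ I ^ m := by
  unfold contractedPower
  rw [Ideal.mem_comap, IsLocalization.algebraMap_mem_map_algebraMap_iff P.primeCompl]
  rfl

theorem Qsub_eq_contractedPower_one {R : Type*} [CommRing R] (I P : Ideal R) (hP : P.IsPrime) :
    Qsub I P hP = contractedPower I 1 P hP := by
  simp [Qsub, contractedPower]

theorem contractedPower_anti {R : Type*} [CommRing R] (I : Ideal R) (m : ℕ) {P P' : Ideal R}
    (hP : P.IsPrime) (hP' : P'.IsPrime) (h : P ≤ P') :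
    contractedPower I m P' hP' ≤ contractedPower I m P hP := by
  intro f hf
  rw [mem_contractedPower_iff] at hf ⊢
  obtain ⟨g, hg, hgf⟩ := hf
  exact ⟨g, fun h' => hg (h h'), hgf⟩

theorem Qsub_pow_le_contractedPower {R : Type*} [CommRing R] (I : Ideal R) (m : ℕ)
    (P : Ideal R) (hP : P.IsPrime) : Qsub I P hP ^ m ≤ contractedPower I m P hP := by
  unfold Qsub contractedPower
  rw [Ideal.map_pow]
  exact Ideal.le_comap_pow _ m

theorem exists_mem_support_of_notMem {σ k : Type*} [CommRing k] (P : Ideal (MvPolynomial σ k))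
    (g : MvPolynomial σ k) (hg : g ∉ P) : ∃ b ∈ g.support, ∀ i ∈ idealVars P, b i = 0 := by
  by_contra! h
  have hle : Ideal.span (X '' idealVars P) ≤ P := Ideal.span_le.2 (by rintro _ ⟨i, hi, rfl⟩; exact hi)
  exact hg (hle (mem_ideal_span_X_image.2 h))

open Classical in
theorem exists_filter_le_of_mem_contractedPower {σ k : Type*} [Field k] (T : Set (σ →₀ ℕ)) (m : ℕ)
    (P : Ideal (MvPolynomial σ k)) (hP : P.IsPrime) (f : MvPolynomial σ k)
    (hf : f ∈ contractedPower
      (Ideal.span ((fun a => (monomial a (1 : k) : MvPolynomial σ k)) '' T)) m P hP) :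
    ∀ a ∈ f.support, ∃ u ∈ sumsOf T m, u.filter (· ∈ idealVars P) ≤ a := by
  obtain ⟨g, hg, hgf⟩ := (mem_contractedPower_iff _ m P hP f).1 hf
  exact exists_filter_le_of_mul_mem _ _ f g (span_monomial_pow_le T m hgf)
    (exists_mem_support_of_notMem P g hg)

open Classical in
theorem monomial_mem_Qsub_iff {σ k : Type*} [Field k] (T : Set (σ →₀ ℕ))
    (P : Ideal (MvPolynomial σ k)) (hP : P.IsPrime) (a : σ →₀ ℕ) :
    monomial a (1 : k) ∈ Qsub
      (Ideal.span ((fun a => (monomial a (1 : k) : MvPolynomial σ k)) '' T)) P hP ↔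
      ∃ s ∈ T, s.filter (· ∈ idealVars P) ≤ a := by
  rw [Qsub_eq_contractedPower_one]
  constructor
  · intro h
    simpa [sumsOf] using exists_filter_le_of_mem_contractedPower T 1 P hP _ h a (by simp)
  · rintro ⟨s, hs, hsa⟩
    rw [mem_contractedPower_iff, pow_one]
    refine ⟨monomial (s.filter (· ∉ idealVars P)) 1, ?_, ?_⟩
    · rw [monomial_eq, C_1, one_mul]
      unfold Finsupp.prod
      rw [hP.prod_mem_iff]
      rintro ⟨i, hi, h⟩
      rw [Finsupp.support_filter, Finset.mem_filter] at hi
      exact hi.2 (hP.mem_of_pow_mem _ h)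
    · obtain ⟨r, rfl⟩ := le_iff_exists_add.1 hsa
      rw [monomial_mul, mem_ideal_span_monomial_image]
      intro x hx
      refine ⟨s, hs, ?_⟩
      have hx' : x = _ := Finset.mem_singleton.1 (support_monomial_subset hx)
      rw [hx', ← add_assoc, add_comm (s.filter _), Finsupp.filter_add_filter_not]
      exact le_self_add

open Classical in
theorem expVec_mem_smul_convexHull {n : ℕ} (L : Set (Fin (n + 1) → ℝ))
    (T : Set (Fin (n + 1) →₀ ℕ)) (A : Set (Fin (n + 1)))
    (hL : ∀ a, (∃ s ∈ T, s.filter (· ∈ A) ≤ a) → expVec a ∈ L) (m : ℕ) (hm : 1 ≤ m)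
    (a : Fin (n + 1) →₀ ℕ) (ha : ∃ u ∈ sumsOf T m, u.filter (· ∈ A) ≤ a) :
    expVec a ∈ (m : ℝ) • convexHull ℝ L := by
  induction m, hm using Nat.le_induction generalizing a with
  | base =>
    rw [Nat.cast_one, one_smul]
    exact subset_convexHull ℝ L (hL a (by simpa [sumsOf] using ha))
  | succ m hm ih =>
    obtain ⟨_, ⟨u, hu, s, hs, rfl⟩, hle⟩ := ha
    dsimp only at hle
    rw [Finsupp.filter_add] at hle
    obtain ⟨r, rfl⟩ := le_iff_exists_add.1 hle
    rw [Nat.cast_succ, (convex_convexHull ℝ L).add_smul (Nat.cast_nonneg m) zero_le_one, one_smul]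
    refine ⟨expVec (u.filter (· ∈ A)), ih _ ⟨u, hu, le_rfl⟩, expVec (s.filter (· ∈ A) + r),
      subset_convexHull ℝ L (hL _ ⟨s, hs, le_self_add⟩), ?_⟩
    funext i
    simp [expVec, add_assoc]

/-- `v` is the sum of a convex combination of the points `u j` and a nonnegative vector. -/
def DominatesConvexComb {J σ : Type*} [Fintype J] (u : J → σ → ℕ) (v : σ → ℝ) : Prop :=
  ∃ (c : J → ℝ) (w : σ → ℝ), (∀ j, 0 ≤ c j) ∧ (∀ i, 0 ≤ w i) ∧ ∑ j, c j = 1 ∧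
    ∀ i, v i = ∑ j, (u j i : ℝ) * c j + w i

theorem DominatesConvexComb.nonneg {J σ : Type*} [Fintype J] {u : J → σ → ℕ} {v : σ → ℝ}
    (h : DominatesConvexComb u v) (i : σ) : 0 ≤ v i := by
  obtain ⟨c, w, hc, hw, -, hv⟩ := h
  rw [hv]
  exact add_nonneg (Finset.sum_nonneg fun j _ => mul_nonneg (Nat.cast_nonneg _) (hc j)) (hw i)

theorem convex_setOf_dominatesConvexComb {J σ : Type*} [Fintype J] (u : J → σ → ℕ) :
    Convex ℝ {v | DominatesConvexComb u v} := by
  rintro x ⟨c, w, hc, hw, hc1, hx⟩ y ⟨c', w', hc', hw', hc1', hy⟩ p q hp hq hpq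
  refine ⟨p • c + q • c', p • w + q • w', fun j => ?_, fun i => ?_, ?_, fun i => ?_⟩
  · exact add_nonneg (mul_nonneg hp (hc j)) (mul_nonneg hq (hc' j))
  · exact add_nonneg (mul_nonneg hp (hw i)) (mul_nonneg hq (hw' i))
  · simp [Finset.sum_add_distrib, ← Finset.mul_sum, hc1, hc1', hpq]
  · simp only [Pi.add_apply, Pi.smul_apply, smul_eq_mul, hx i, hy i, mul_add,
      Finset.sum_add_distrib, Finset.mul_sum, mul_left_comm _ p, mul_left_comm _ q]
    ring

open Classical in
theorem dominatesConvexComb_of_mem_convexHull {k : Type*} [Field k] {n : ℕ}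
    (T : Finset (Fin (n + 1) →₀ ℕ)) (P : Ideal (MvPolynomial (Fin (n + 1)) k)) (hP : P.IsPrime)
    (v : Fin (n + 1) → ℝ) (hv : v ∈ convexHull ℝ (latticePoints (Qsub
      (Ideal.span ((fun a => (monomial a (1 : k) : MvPolynomial (Fin (n + 1)) k)) '' T)) P hP))) :
    DominatesConvexComb (fun (s : T) i => s.1.filter (· ∈ idealVars P) i) v := by
  refine convexHull_min ?_ (convex_setOf_dominatesConvexComb _) hv
  rintro _ ⟨a, ha, rfl⟩
  obtain ⟨s, hs, hsa⟩ := (monomial_mem_Qsub_iff _ P hP a).1 ha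
  refine ⟨Pi.single ⟨s, hs⟩ 1, fun i => (a i : ℝ) - (s.filter (· ∈ idealVars P) i : ℕ),
    fun j => ?_, fun i => ?_, by simp, fun i => ?_⟩
  · by_cases h : j = ⟨s, hs⟩
    · subst h; simp
    · simp [h]
  · exact sub_nonneg.2 (Nat.cast_le.2 (hsa i))
  · simp [Pi.single_apply, expVec]

theorem exists_common_denominator {ι : Type*} [Fintype ι] (q : ι → ℚ) (hq : ∀ i, 0 ≤ q i) :
    ∃ N : ℕ, 1 ≤ N ∧ ∃ p : ι → ℕ, ∀ i, (p i : ℚ) = N * q i := by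
  classical
  refine ⟨∏ i, (q i).den, Finset.prod_pos fun i _ => (q i).den_pos,
    fun i => (∏ j ∈ Finset.univ.erase i, (q j).den) * (q i).num.toNat, fun i => ?_⟩
  have h : ((q i).num.toNat : ℚ) = (q i).den * q i := by
    rw [Rat.den_mul_eq_num]
    exact_mod_cast Int.toNat_of_nonneg (Rat.num_nonneg.2 (hq i))
  rw [← Finset.prod_erase_mul _ _ (Finset.mem_univ i), Nat.cast_mul, Nat.cast_mul, h, mul_assoc]

open Classical in
/-- The matrix of the linear system in `v`, `c`, `w` expressing that, for each `A`, the `c A j` add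
up to `1` and `v` is the combination of the `u A j` with coefficients `c A j`, plus `w A`. -/
noncomputable def combMatrix (K : Type*) [Field K] {Λ J σ : Type*} (u : Λ → J → σ → ℕ) :
    (Λ × σ) ⊕ Λ → σ ⊕ (Λ × J) ⊕ (Λ × σ) → K :=
  Sum.elim
    (fun r => Sum.elim (fun i => if i = r.2 then -1 else 0)
      (Sum.elim (fun s => if s.1 = r.1 then (u r.1 s.2 r.2 : K) else 0)
        (fun s => if s = r then 1 else 0)))
    (fun A => Sum.elim (fun _ => 0)
      (Sum.elim (fun s => if s.1 = A then 1 else 0) (fun _ => 0)))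

theorem combMatrix_ratCast {Λ J σ : Type*} (u : Λ → J → σ → ℕ) (r : (Λ × σ) ⊕ Λ)
    (x : σ ⊕ (Λ × J) ⊕ (Λ × σ)) : ((combMatrix ℚ u r x : ℚ) : ℝ) = combMatrix ℝ u r x := by
  rcases r with r | r <;> rcases x with x | x | x <;>
    simp only [combMatrix, Sum.elim_inl, Sum.elim_inr] <;> (try split_ifs) <;> simp

theorem sum_combMatrix_inl {K Λ J σ : Type*} [Field K] [Fintype Λ] [Fintype J] [Fintype σ]
    (u : Λ → J → σ → ℕ) (z : σ ⊕ (Λ × J) ⊕ (Λ × σ) → K) (A : Λ) (i : σ) :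
    ∑ x, combMatrix K u (Sum.inl (A, i)) x * z x =
      -z (Sum.inl i) + (∑ j, (u A j i : K) * z (Sum.inr (Sum.inl (A, j))) +
        z (Sum.inr (Sum.inr (A, i)))) := by
  classical
  simp only [combMatrix, Sum.elim_inl, Sum.elim_inr, Fintype.sum_sum_type, ite_mul, zero_mul,
    Finset.sum_ite_eq', Finset.mem_univ, if_true, neg_mul, one_mul]
  congr 2
  rw [Fintype.sum_prod_type, Finset.sum_eq_single A]
  · simp
  · intro B _ hB
    simp [hB]
  · simp

theorem sum_combMatrix_inr {K Λ J σ : Type*} [Field K] [Fintype Λ] [Fintype J] [Fintype σ]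
    (u : Λ → J → σ → ℕ) (z : σ ⊕ (Λ × J) ⊕ (Λ × σ) → K) (A : Λ) :
    ∑ x, combMatrix K u (Sum.inr A) x * z x = ∑ j, z (Sum.inr (Sum.inl (A, j))) := by
  classical
  simp only [combMatrix, Sum.elim_inl, Sum.elim_inr, Fintype.sum_sum_type, ite_mul, zero_mul,
    one_mul, Finset.sum_const_zero, zero_add, add_zero]
  rw [Fintype.sum_prod_type, Finset.sum_eq_single A]
  · simp
  · intro B _ hB
    simp [hB]
  · simp

/-- The minimum of the coordinate sum over a nonempty intersection of finitely many polyhedra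
`conv(u A) + ℝ≥0^σ` is attained at a rational point, given here with denominators cleared. -/
theorem exists_nat_optimal {Λ J σ : Type*} [Fintype Λ] [Fintype J] [Fintype σ]
    (u : Λ → J → σ → ℕ)
    (hne : ∃ v : σ → ℝ, (∀ i, 0 ≤ v i) ∧ ∀ A, DominatesConvexComb (u A) v) :
    ∃ N : ℕ, 1 ≤ N ∧ ∃ (a : σ → ℕ) (c : Λ → J → ℕ) (w : Λ → σ → ℕ),
      (∀ A, ∑ j, c A j = N) ∧ (∀ A i, a i = ∑ j, u A j i * c A j + w A i) ∧
      ∀ v : σ → ℝ, (∀ i, 0 ≤ v i) → (∀ A, DominatesConvexComb (u A) v) →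
        ((∑ i, a i : ℕ) : ℝ) ≤ N * ∑ i, v i := by
  let b : (Λ × σ) ⊕ Λ → ℚ := Sum.elim (fun _ => 0) (fun _ => 1)
  have feas : ∀ v : σ → ℝ, (∀ i, 0 ≤ v i) → (∀ A, DominatesConvexComb (u A) v) →
      ∃ z : σ ⊕ (Λ × J) ⊕ (Λ × σ) → ℝ, (∀ x, 0 ≤ z x) ∧
        (∀ r, ∑ x, ((combMatrix ℚ u r x : ℚ) : ℝ) * z x = b r) ∧ ∀ i, z (Sum.inl i) = v i := by
    intro v hv h
    choose c w hc hw hc1 hvc using h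
    refine ⟨Sum.elim v (Sum.elim (fun s => c s.1 s.2) (fun s => w s.1 s.2)), ?_, ?_,
      fun i => rfl⟩
    · rintro (i | s | s)
      exacts [hv i, hc _ _, hw _ _]
    · simp only [combMatrix_ratCast]
      rintro (⟨A, i⟩ | A)
      · rw [sum_combMatrix_inl]
        simp [b, ← hvc A i]
      · rw [sum_combMatrix_inr]
        simp [b, hc1]
  obtain ⟨v₀, hv₀, h₀⟩ := hne
  obtain ⟨z₀, hz₀, hMz₀, -⟩ := feas v₀ hv₀ h₀
  obtain ⟨q, hq, hMq, hopt⟩ := exists_rat_optimal (combMatrix ℚ u) b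
    (Sum.elim (fun _ => 1) (fun _ => 0)) (by rintro (i | i) <;> simp) ⟨z₀, hz₀, hMz₀⟩
  obtain ⟨N, hN, p, hp⟩ := exists_common_denominator q hq
  refine ⟨N, hN, fun i => p (Sum.inl i), fun A j => p (Sum.inr (Sum.inl (A, j))),
    fun A i => p (Sum.inr (Sum.inr (A, i))), fun A => ?_, fun A i => ?_, fun v hv h => ?_⟩
  · have h := hMq (Sum.inr A)
    rw [sum_combMatrix_inr] at h
    have h' : ((∑ j, p (Sum.inr (Sum.inl (A, j))) : ℕ) : ℚ) = N := by
      simp only [Nat.cast_sum, hp, ← Finset.mul_sum, h]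
      simp [b]
    exact_mod_cast h'
  · have h := hMq (Sum.inl (A, i))
    rw [sum_combMatrix_inl] at h
    have h' : ((p (Sum.inl i) : ℕ) : ℚ) =
        ((∑ j, u A j i * p (Sum.inr (Sum.inl (A, j))) + p (Sum.inr (Sum.inr (A, i))) : ℕ) : ℚ) := by
      simp only [Nat.cast_add, Nat.cast_sum, Nat.cast_mul, hp, mul_left_comm _ (N : ℚ),
        ← Finset.mul_sum, ← mul_add]
      simp only [b, Sum.elim_inl] at h
      congr 1
      linarith
    exact_mod_cast h'
  · obtain ⟨z, hz, hMz, hzv⟩ := feas v hv h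
    have h1 := hopt z hz hMz
    simp only [Fintype.sum_sum_type, Sum.elim_inl, Sum.elim_inr, one_mul, zero_mul,
      Finset.sum_const_zero, add_zero, hzv] at h1
    have h2 : ((∑ i, p (Sum.inl i) : ℕ) : ℝ) = N * ∑ i, (q (Sum.inl i) : ℝ) := by
      rw [Nat.cast_sum, Finset.mul_sum]
      refine Finset.sum_congr rfl fun i _ => ?_
      exact_mod_cast congr_arg (Rat.cast : ℚ → ℝ) (hp (Sum.inl i))
    rw [h2]
    exact mul_le_mul_of_nonneg_left h1 (Nat.cast_nonneg N)

theorem IsMonomialIdeal.exists_finset {k : Type*} [Field k] {n : ℕ}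
    {I : Ideal (MvPolynomial (Fin (n + 1)) k)} (h : IsMonomialIdeal I) :
    ∃ T : Finset (Fin (n + 1) →₀ ℕ),
      I = Ideal.span ((fun a => (monomial a (1 : k) : MvPolynomial (Fin (n + 1)) k)) '' T) := by
  classical
  obtain ⟨S, rfl⟩ := h
  obtain ⟨s', hs', hspan⟩ := (Submodule.fg_span_iff_fg_span_finset_subset _).1
    (IsNoetherian.noetherian (Ideal.span
      ((fun a => (monomial a (1 : k) : MvPolynomial (Fin (n + 1)) k)) '' S)))
  obtain ⟨T, -, rfl⟩ := Finset.subset_set_image_iff.1 hs'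
  exact ⟨T, by rw [Finset.coe_image] at hspan; exact hspan⟩

theorem exists_le_mem_maxAss {R : Type*} [CommRing R] [IsNoetherianRing R] (I P : Ideal R)
    (hP : P ∈ associatedPrimes R (R ⧸ I)) : ∃ P' ∈ maxAss I, P ≤ P' := by
  obtain ⟨P', ⟨hP', hle⟩, hmax⟩ := WellFounded.has_min (wellFounded_gt (α := Ideal R))
    {P' | P' ∈ associatedPrimes R (R ⧸ I) ∧ P ≤ P'} ⟨P, hP, le_rfl⟩
  refine ⟨P', ⟨hP', fun P'' hP'' h => ?_⟩, hle⟩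
  by_contra hne
  exact hmax P'' ⟨hP'', hle.trans h⟩ (lt_of_le_of_ne h hne)

theorem mem_symbolicPower_of_forall_maxAss {R : Type*} [CommRing R] [IsNoetherianRing R]
    (I : Ideal R) (m : ℕ) (f : R)
    (h : ∀ P, ∀ hP : P ∈ maxAss I, f ∈ contractedPower I m P hP.1.isPrime) :
    f ∈ symbolicPower I m := by
  unfold symbolicPower
  rw [Submodule.mem_iInf]
  rintro ⟨P, hP⟩
  obtain ⟨P', hP', hle⟩ := exists_le_mem_maxAss I P hP
  exact contractedPower_anti I m hP.isPrime hP'.1.isPrime hle (h P' hP')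

theorem pow_le_symbolicPower {R : Type*} [CommRing R] (I : Ideal R) (m : ℕ) :
    I ^ m ≤ symbolicPower I m :=
  le_iInf fun _ => Ideal.le_comap_map

theorem alphaI_le_of_monomial_mem {k : Type*} [Field k] {n : ℕ}
    (J : Ideal (MvPolynomial (Fin (n + 1)) k)) (a : Fin (n + 1) →₀ ℕ)
    (ha : monomial a (1 : k) ∈ J) : alphaI J ≤ ∑ i, a i :=
  Nat.sInf_le ⟨_, ha, by simp, isHomogeneous_monomial 1 (Finsupp.degree_eq_sum a)⟩

theorem exists_mem_support_sum_eq_alphaI {k : Type*} [Field k] {n : ℕ}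
    (J : Ideal (MvPolynomial (Fin (n + 1)) k)) (a : Fin (n + 1) →₀ ℕ)
    (ha : monomial a (1 : k) ∈ J) : ∃ f ∈ J, ∃ b ∈ f.support, ∑ i, b i = alphaI J := by
  obtain ⟨f, hf, hf0, hd⟩ := Nat.sInf_mem (s := {d | ∃ f ∈ J, f ≠ 0 ∧ IsHomogeneous f d})
    ⟨_, _, ha, by simp, isHomogeneous_monomial 1 rfl⟩
  obtain ⟨b, hb⟩ := support_nonempty.2 hf0
  refine ⟨f, hf, b, hb, ?_⟩
  rw [← Finsupp.degree_eq_sum, Finsupp.degree_eq_weight_one]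
  exact hd (mem_support_iff.1 hb)

theorem monomial_smul_mem_pow {σ k : Type*} [CommSemiring k] (J : Ideal (MvPolynomial σ k))
    (a : σ →₀ ℕ) (ha : monomial a (1 : k) ∈ J) (m : ℕ) : monomial (m • a) (1 : k) ∈ J ^ m := by
  have h := Ideal.pow_mem_pow ha m
  rwa [monomial_pow, one_pow] at h

theorem monomial_sum_smul_add_mem_pow {σ k ι : Type*} [CommSemiring k] [Fintype ι]
    (J : Ideal (MvPolynomial σ k)) (u : ι → σ →₀ ℕ) (hu : ∀ s, monomial (u s) (1 : k) ∈ J)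
    (c : ι → ℕ) (w : σ →₀ ℕ) :
    monomial (∑ s, c s • u s + w) (1 : k) ∈ J ^ ∑ s, c s := by
  have h := Ideal.mul_mem_right (monomial w 1) _
    (Ideal.prod_mem_prod (s := Finset.univ) fun s _ => monomial_smul_mem_pow J (u s) (hu s) (c s))
  rwa [Finset.prod_pow_eq_pow_sum, ← monomial_sum_one, monomial_mul, one_mul] at h

theorem exists_monomial_mem_symbolicPower {k : Type*} [Field k] {n : ℕ}
    (I : Ideal (MvPolynomial (Fin (n + 1)) k)) (hmon : IsMonomialIdeal I) (hI : I ≠ ⊥) (m : ℕ) :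
    ∃ a, monomial a (1 : k) ∈ symbolicPower I m := by
  obtain ⟨S, rfl⟩ := hmon
  have hS : S.Nonempty := by
    rw [Set.nonempty_iff_ne_empty]
    rintro rfl
    exact hI (by simp)
  obtain ⟨s, hs⟩ := hS
  refine ⟨m • s, pow_le_symbolicPower _ m ?_⟩
  have hmem : monomial s (1 : k) ∈
      Ideal.span ((fun a => (monomial a (1 : k) : MvPolynomial (Fin (n + 1)) k)) '' S) :=
    Ideal.subset_span ⟨s, hs, rfl⟩
  exact monomial_smul_mem_pow _ s hmem m

/-- Every monomial of an element of `I^{(m)}` has its exponent vector in `m • 𝒬`. -/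
theorem exists_expVec_eq_smul_of_mem_symbolicPower {k : Type*} [Field k] {n : ℕ}
    (I : Ideal (MvPolynomial (Fin (n + 1)) k)) (hmon : IsMonomialIdeal I) (m : ℕ) (hm : 1 ≤ m)
    (f : MvPolynomial (Fin (n + 1)) k) (hf : f ∈ symbolicPower I m) (a : Fin (n + 1) →₀ ℕ)
    (ha : a ∈ f.support) : ∃ v ∈ symbolicPolyhedron I, expVec a = (m : ℝ) • v := by
  obtain ⟨T, rfl⟩ := hmon
  have hm0 : (m : ℝ) ≠ 0 := by positivity
  refine ⟨(m : ℝ)⁻¹ • expVec a, ?_, (smul_inv_smul₀ hm0 _).symm⟩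
  refine Set.mem_iInter.2 fun P => ?_
  rw [← Set.mem_smul_set_iff_inv_smul_mem₀ hm0]
  have hfP := (Submodule.mem_iInf _).1 hf ⟨P.1, P.2.1⟩
  refine expVec_mem_smul_convexHull _ T (idealVars P.1) (fun b hb => ?_) m hm a
    (exists_filter_le_of_mem_contractedPower T m P.1 P.2.1.isPrime f hfP a ha)
  exact ⟨b, (monomial_mem_Qsub_iff T P.1 P.2.1.isPrime b).2 hb, rfl⟩

theorem nonneg_of_mem_symbolicPolyhedron {k : Type*} [Field k] {n : ℕ}
    (I : Ideal (MvPolynomial (Fin (n + 1)) k)) (hmon : IsMonomialIdeal I)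
    (hne : (maxAss I).Nonempty) (v : Fin (n + 1) → ℝ) (hv : v ∈ symbolicPolyhedron I)
    (i : Fin (n + 1)) : 0 ≤ v i := by
  obtain ⟨T, rfl⟩ := hmon.exists_finset
  obtain ⟨P, hP⟩ := hne
  exact (dominatesConvexComb_of_mem_convexHull T P hP.1.isPrime v
    (Set.mem_iInter.1 hv ⟨P, hP⟩)).nonneg i

theorem mul_alphaSet_le_alphaI {k : Type*} [Field k] {n : ℕ}
    (I : Ideal (MvPolynomial (Fin (n + 1)) k)) (hmon : IsMonomialIdeal I) (hI : I ≠ ⊥)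
    (hne : (maxAss I).Nonempty) (m : ℕ) (hm : 1 ≤ m) :
    (m : ℝ) * alphaSet (symbolicPolyhedron I) ≤ (alphaI (symbolicPower I m) : ℝ) := by
  obtain ⟨a, ha⟩ := exists_monomial_mem_symbolicPower I hmon hI m
  obtain ⟨f, hf, b, hb, hsum⟩ := exists_mem_support_sum_eq_alphaI _ a ha
  obtain ⟨v, hv, hbv⟩ := exists_expVec_eq_smul_of_mem_symbolicPower I hmon m hm f hf b hb
  have h : (alphaI (symbolicPower I m) : ℝ) = m * ∑ i, v i := by
    rw [← hsum, Nat.cast_sum, Finset.mul_sum]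
    exact Finset.sum_congr rfl fun i _ => congr_fun hbv i
  rw [h]
  refine mul_le_mul_of_nonneg_left (csInf_le ⟨0, ?_⟩ ⟨v, hv, rfl⟩) (Nat.cast_nonneg m)
  rintro _ ⟨w, hw, rfl⟩
  exact Finset.sum_nonneg fun i _ => nonneg_of_mem_symbolicPolyhedron I hmon hne w hw i

/-- The minimum defining `α(𝒬)` is attained at a rational point `a / N` such that `x^a` lies in
`Q_{⊆P}^N` for all maximal associated primes `P`. -/
theorem exists_monomial_mem_Qsub_pow {k : Type*} [Field k] {n : ℕ}
    (I : Ideal (MvPolynomial (Fin (n + 1)) k)) (hmon : IsMonomialIdeal I) (hI : I ≠ ⊥)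
    (hne : (maxAss I).Nonempty) :
    ∃ N : ℕ, 1 ≤ N ∧ ∃ a : Fin (n + 1) →₀ ℕ,
      (∀ P, ∀ hP : P ∈ maxAss I, monomial a (1 : k) ∈ Qsub I P hP.1.isPrime ^ N) ∧
      ((∑ i, a i : ℕ) : ℝ) ≤ N * alphaSet (symbolicPolyhedron I) := by
  classical
  obtain ⟨v₀, hv₀⟩ : (symbolicPolyhedron I).Nonempty := by
    obtain ⟨a, ha⟩ := exists_monomial_mem_symbolicPower I hmon hI 1
    obtain ⟨v, hv, -⟩ := exists_expVec_eq_smul_of_mem_symbolicPower I hmon 1 le_rfl _ ha a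
      (by simp)
    exact ⟨v, hv⟩
  have hnonneg := nonneg_of_mem_symbolicPolyhedron I hmon hne
  obtain ⟨T, hT⟩ := hmon.exists_finset
  have : Fintype (idealVars '' maxAss I) := Fintype.ofFinite _
  have hdom : ∀ v ∈ symbolicPolyhedron I, ∀ A : idealVars '' maxAss I,
      DominatesConvexComb (fun (s : T) i => s.1.filter (· ∈ A.1) i) v := by
    rintro v hv ⟨_, P, hP, rfl⟩
    subst hT
    exact dominatesConvexComb_of_mem_convexHull T P hP.1.isPrime v
      (Set.mem_iInter.1 hv ⟨P, hP⟩)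
  obtain ⟨N, hN, a, c, w, hc, ha, hopt⟩ := exists_nat_optimal
    (fun (A : idealVars '' maxAss I) (s : T) i => s.1.filter (· ∈ A.1) i)
    ⟨v₀, hnonneg v₀ hv₀, hdom v₀ hv₀⟩
  refine ⟨N, hN, Finsupp.equivFunOnFinite.symm a, fun P hP => ?_, ?_⟩
  · let A : idealVars '' maxAss I := ⟨idealVars P, P, hP, rfl⟩
    have haA : Finsupp.equivFunOnFinite.symm a =
        ∑ s, c A s • s.1.filter (· ∈ A.1) + Finsupp.equivFunOnFinite.symm (w A) := by
      ext i
      rw [Finsupp.add_apply, Finsupp.finsetSum_apply]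
      refine (ha A i).trans (congr_arg (· + w A i) (Finset.sum_congr rfl fun s _ => ?_))
      exact mul_comm _ _
    rw [haA, ← hc A]
    refine monomial_sum_smul_add_mem_pow _ _ (fun s => ?_) _ _
    have h := (monomial_mem_Qsub_iff (T : Set (Fin (n + 1) →₀ ℕ)) P hP.1.isPrime
      (s.1.filter (· ∈ idealVars P))).2 ⟨s.1, s.2, le_rfl⟩
    rw [← hT] at h
    exact h
  · have hN0 : (0 : ℝ) < N := by positivity
    refine (div_le_iff₀' hN0).1 ?_
    refine le_csInf (Set.Nonempty.image _ ⟨v₀, hv₀⟩) ?_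
    rintro _ ⟨v, hv, rfl⟩
    refine (div_le_iff₀' hN0).2 ?_
    exact hopt v (hnonneg v hv) (hdom v hv)

theorem alpha_symbolic_power_ge {k : Type*} [Field k] {n : ℕ}
    (I : Ideal (MvPolynomial (Fin (n + 1)) k)) (hmon : IsMonomialIdeal I) (hI : I ≠ ⊥) :
    (∀ m : ℕ, 1 ≤ m →
      (m : ℝ) * alphaSet (symbolicPolyhedron I) ≤ (alphaI (symbolicPower I m) : ℝ)) ∧
    {m : ℕ | (alphaI (symbolicPower I m) : ℝ) =
      (m : ℝ) * alphaSet (symbolicPolyhedron I)}.Infinite := by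
  rcases (maxAss I).eq_empty_or_nonempty with hempty | hne
  · have hα : alphaSet (symbolicPolyhedron I) = 0 := by
      have huniv : symbolicPolyhedron I = Set.univ :=
        Set.iInter_eq_univ.2 fun P => absurd P.2 (by simp [hempty])
      rw [huniv, alphaSet, Set.image_univ, Set.range_eq_univ.2, Real.sInf_univ]
      intro r
      exact ⟨Pi.single 0 r, by simp⟩
    have hαI : ∀ m, alphaI (symbolicPower I m) = 0 := fun m => by
      refine Nat.le_zero.1 ((alphaI_le_of_monomial_mem _ 0 ?_).trans (by simp))
      refine mem_symbolicPower_of_forall_maxAss I m _ fun P hP => ?_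
      simp [hempty] at hP
    simp [hα, hαI, Set.infinite_univ]
  · have hge := mul_alphaSet_le_alphaI I hmon hI hne
    refine ⟨hge, ?_⟩
    obtain ⟨N, hN, a, ha, hle⟩ := exists_monomial_mem_Qsub_pow I hmon hI hne
    refine Set.infinite_of_injective_forall_mem (f := fun t : ℕ => N * (t + 1)) ?_ fun t => ?_
    · intro s t h
      simpa [Nat.one_le_iff_ne_zero.1 hN] using h
    · refine le_antisymm ?_ (hge _ (Nat.mul_pos hN t.succ_pos))
      have hmem : monomial ((t + 1) • a) (1 : k) ∈ symbolicPower I (N * (t + 1)) := by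
        refine mem_symbolicPower_of_forall_maxAss I _ _ fun P hP => ?_
        refine Qsub_pow_le_contractedPower I _ P hP.1.isPrime ?_
        rw [pow_mul]
        exact monomial_smul_mem_pow _ a (ha P hP) (t + 1)
      have h := alphaI_le_of_monomial_mem _ _ hmem
      calc (alphaI (symbolicPower I (N * (t + 1))) : ℝ)
          ≤ ((∑ i, ((t + 1) • a) i : ℕ) : ℝ) := by exact_mod_cast h
        _ = (t + 1) * ((∑ i, a i : ℕ) : ℝ) := by
          simp [← Finset.mul_sum]
        _ ≤ (t + 1) * (N * alphaSet (symbolicPolyhedron I)) := by gcongr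
        _ = _ := by push_cast; ring
end

section
/- Let R = k[x_0,…,x_n] be a polynomial ring over a field k, let 𝔪 = (x_0,…,x_n), let I ⊆ R be a monomial ideal with big-height e, and let 𝒬 be the symbolic polyhedron of I. Then for all integers r ≥ 0 and all integers m with m ≥ er and m·α(𝒬) ≥ β(I^r), one has I^{(m)} ⊆ 𝔪^{⌈α(𝒬)·m⌉ − β(I^r)} · I^r. -/
open MvPolynomial Pointwise

/-! ### Height of a prime containing given variables -/

/-- The ring endomorphism sending the variables in `T` to zero and fixing the others. -/
noncomputable def killVars (k : Type*) [Field k] {σ : Type*} [DecidableEq σ] (T : Finset σ) :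
    MvPolynomial σ k →+* MvPolynomial σ k :=
  (aeval (R := k) fun i => if i ∈ T then 0 else X i).toRingHom

theorem killVars_X {k : Type*} [Field k] {σ : Type*} [DecidableEq σ] (T : Finset σ) (i : σ) :
    killVars k T (X i) = if i ∈ T then 0 else X i := by
  simp [killVars]

theorem ker_killVars_le {k : Type*} [Field k] {σ : Type*} [DecidableEq σ] (T : Finset σ)
    (P : Ideal (MvPolynomial σ k)) (h : ∀ i ∈ T, (X i : MvPolynomial σ k) ∈ P) :
    RingHom.ker (killVars k T) ≤ P := by
  have key : (Ideal.Quotient.mk P).comp (killVars k T) = Ideal.Quotient.mk P := by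
    refine MvPolynomial.ringHom_ext (fun c => by simp [killVars]) fun i => ?_
    rw [RingHom.comp_apply, killVars_X]
    split_ifs with hi
    · rw [map_zero, eq_comm, Ideal.Quotient.eq_zero_iff_mem]
      exact h i hi
    · rfl
  intro f hf
  rw [← Ideal.Quotient.eq_zero_iff_mem, ← key, RingHom.comp_apply, (RingHom.mem_ker).1 hf,
    map_zero]

theorem card_le_height_ker_killVars {k : Type*} [Field k] {σ : Type*} [DecidableEq σ]
    (T : Finset σ) :
    (T.card : ℕ∞) ≤ primeHeight (RingHom.ker (killVars k T)) (RingHom.ker_isPrime _) := by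
  induction T using Finset.induction_on with
  | empty => simp
  | insert i T hi ih =>
    rw [Finset.card_insert_of_notMem hi, Nat.cast_add, Nat.cast_one]
    refine le_trans (add_le_add_left ih 1) (Order.height_add_one_le ?_)
    have hle : RingHom.ker (killVars k T) ≤ RingHom.ker (killVars k (insert i T)) :=
      ker_killVars_le T _ fun j hj => by
        rw [RingHom.mem_ker, killVars_X, if_pos (Finset.mem_insert_of_mem hj)]
    refine lt_of_le_not_ge hle fun hge => ?_
    have hmem : (X i : MvPolynomial σ k) ∈ RingHom.ker (killVars k T) := hge <| by
      rw [RingHom.mem_ker, killVars_X, if_pos (Finset.mem_insert_self i T)]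
    rw [RingHom.mem_ker, killVars_X, if_neg hi] at hmem
    exact X_ne_zero i hmem

theorem card_le_primeHeight {k : Type*} [Field k] {σ : Type*} [DecidableEq σ] (T : Finset σ)
    (P : Ideal (MvPolynomial σ k)) (hP : P.IsPrime)
    (h : ∀ i ∈ T, (X i : MvPolynomial σ k) ∈ P) :
    (T.card : ℕ∞) ≤ primeHeight P hP :=
  (card_le_height_ker_killVars (k := k) T).trans (Order.height_mono (ker_killVars_le T P h))

/-! ### Monomials and localization -/

theorem mem_Qsub_iff {R : Type*} [CommRing R] (J P : Ideal R)
    (hP : P.IsPrime) (x : R) :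
    x ∈ Qsub J P hP ↔ ∃ s ∉ P, s * x ∈ J := by
  have := hP
  rw [Qsub, Ideal.mem_comap,
    IsLocalization.algebraMap_mem_map_algebraMap_iff P.primeCompl (Localization.AtPrime P)]
  rfl

theorem monomial_notMem_of_disjoint {k : Type*} [Field k] {σ : Type*}
    {P : Ideal (MvPolynomial σ k)} (hP : P.IsPrime) {w : σ →₀ ℕ}
    (hw : ∀ i, (X i : MvPolynomial σ k) ∈ P → w i = 0) : monomial w (1 : k) ∉ P := by
  rw [monomial_eq, C_1, one_mul, Finsupp.prod]
  intro h
  obtain ⟨i, hi, hmem⟩ := (hP.prod_mem_iff).1 h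
  exact Finsupp.mem_support_iff.1 hi (hw i (hP.mem_of_pow_mem _ hmem))

theorem exists_mem_support_disjoint {k : Type*} [Field k] {σ : Type*}
    {P : Ideal (MvPolynomial σ k)} {s : MvPolynomial σ k} (hs : s ∉ P) :
    ∃ w ∈ s.support, ∀ i, (X i : MvPolynomial σ k) ∈ P → w i = 0 := by
  by_contra! H
  refine hs ?_
  rw [s.as_sum]
  refine Ideal.sum_mem _ fun w hw => ?_
  obtain ⟨i, hi, hwi⟩ := H w hw
  refine P.mem_of_dvd ?_ hi
  exact X_dvd_monomial.2 (Or.inr hwi)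

theorem monomial_mem_of_le {k : Type*} [Field k] {σ : Type*} {J : Ideal (MvPolynomial σ k)}
    {a b : σ →₀ ℕ} (hab : a ≤ b) (ha : monomial a (1 : k) ∈ J) : monomial b (1 : k) ∈ J :=
  J.mem_of_dvd (monomial_dvd_monomial.2 ⟨Or.inr hab, dvd_rfl⟩) ha

theorem monomial_mem_of_mem_support {k : Type*} [Field k] {σ : Type*} {S : Set (σ →₀ ℕ)}
    {f : MvPolynomial σ k}
    (hf : f ∈ Ideal.span ((fun a => (monomial a (1 : k) : MvPolynomial σ k)) '' S))
    {a : σ →₀ ℕ} (ha : a ∈ f.support) :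
    monomial a (1 : k) ∈
      Ideal.span ((fun a => (monomial a (1 : k) : MvPolynomial σ k)) '' S) := by
  obtain ⟨b, hb, hba⟩ := mem_ideal_span_monomial_image.1 hf a ha
  exact monomial_mem_of_le hba (Ideal.subset_span ⟨b, hb, rfl⟩)

/-- If a multiple of `f` by an element outside the prime `P` lies in a monomial ideal, then each
monomial of `f` lies in that ideal after multiplication by a monomial in variables outside `P`. -/
theorem exists_monomial_add_mem {k : Type*} [Field k] {σ : Type*} [Fintype σ]
    {S : Set (σ →₀ ℕ)} {P : Ideal (MvPolynomial σ k)}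
    {f s : MvPolynomial σ k} (hs : s ∉ P)
    (hsf : s * f ∈ Ideal.span ((fun a => (monomial a (1 : k) : MvPolynomial σ k)) '' S))
    {a : σ →₀ ℕ} (ha : a ∈ f.support) :
    ∃ w : σ →₀ ℕ, (∀ i, (X i : MvPolynomial σ k) ∈ P → w i = 0) ∧
      monomial (w + a) (1 : k) ∈
        Ideal.span ((fun a => (monomial a (1 : k) : MvPolynomial σ k)) '' S) := by
  classical
  set J := Ideal.span ((fun a => (monomial a (1 : k) : MvPolynomial σ k)) '' S)
  let off : (σ →₀ ℕ) → Prop := fun w => ∀ i, (X i : MvPolynomial σ k) ∈ P → w i = 0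
  let good : (σ →₀ ℕ) → Prop := fun a => ∃ w, off w ∧ monomial (w + a) (1 : k) ∈ J
  let wt : (σ →₀ ℕ) → ℕ := fun a => ∑ i with (X i : MvPolynomial σ k) ∈ P, a i
  have wt_add (a b) : wt (a + b) = wt a + wt b := by simp [wt, Finset.sum_add_distrib]
  have wt_eq_zero (w) : wt w = 0 ↔ off w := by simp [wt, off]
  change good a
  by_contra hbad
  obtain ⟨a₀, ha₀, hmin⟩ := Finset.exists_min_image (f.support.filter fun a => ¬ good a) wt
    ⟨a, Finset.mem_filter.2 ⟨ha, hbad⟩⟩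
  obtain ⟨w₀, hw₀, hoff⟩ := exists_mem_support_disjoint hs
  obtain ⟨w, hw, c, hc, huniq⟩ := UniqueSums.uniqueAdd_of_nonempty
    (A := s.support.filter off)
    (B := f.support.filter fun a => ¬ good a ∧ wt a = wt a₀)
    ⟨w₀, Finset.mem_filter.2 ⟨hw₀, hoff⟩⟩
    ⟨a₀, Finset.mem_filter.2 ⟨(Finset.mem_filter.1 ha₀).1, (Finset.mem_filter.1 ha₀).2, rfl⟩⟩
  rw [Finset.mem_filter] at hw hc
  have hcoeff : coeff (w + c) (s * f) = coeff w s * coeff c f := by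
    rw [coeff_mul]
    refine Finset.sum_eq_single (w, c) ?_ fun h => by simp at h
    rintro ⟨w', c'⟩ hsum hne
    rw [Finset.HasAntidiagonal.mem_antidiagonal] at hsum
    by_contra hprod
    have hw's : w' ∈ s.support := mem_support_iff.2 (left_ne_zero_of_mul hprod)
    have hc'f : c' ∈ f.support := mem_support_iff.2 (right_ne_zero_of_mul hprod)
    have hc'bad : ¬ good c' := by
      rintro ⟨v, hv, hvc⟩
      refine hc.2.1 ⟨v + w, fun i hi => by simp [hv i hi, hw.2 i hi], ?_⟩
      rw [add_assoc, ← hsum]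
      refine monomial_mem_of_le ?_ hvc
      exact add_le_add_right le_add_self v
    have h1 : wt a₀ ≤ wt c' := hmin c' (Finset.mem_filter.2 ⟨hc'f, hc'bad⟩)
    have h2 : wt w' + wt c' = wt a₀ := by
      rw [← wt_add, hsum, wt_add, (wt_eq_zero w).2 hw.2, hc.2.2, zero_add]
    have h3 := huniq (Finset.mem_filter.2 ⟨hw's, (wt_eq_zero w').1 (by omega)⟩)
      (Finset.mem_filter.2 ⟨hc'f, hc'bad, by omega⟩) hsum
    exact hne (Prod.ext h3.1 h3.2)
  refine hc.2.1 ⟨w, hw.2, monomial_mem_of_mem_support hsf (mem_support_iff.2 ?_)⟩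
  rw [hcoeff]
  exact mul_ne_zero (mem_support_iff.1 hw.1) (mem_support_iff.1 hc.1)

/-! ### Powers of monomial ideals -/

theorem span_monomial_pow {k : Type*} [Field k] {σ : Type*} (S : Set (σ →₀ ℕ)) (r : ℕ) :
    Ideal.span ((fun a => (monomial a (1 : k) : MvPolynomial σ k)) '' S) ^ r =
      Ideal.span ((fun a => (monomial a (1 : k) : MvPolynomial σ k)) ''
        {a | ∃ g : Fin r → σ →₀ ℕ, (∀ j, g j ∈ S) ∧ ∑ j, g j = a}) := by
  induction r with
  | zero => simp [Ideal.one_eq_top]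
  | succ r ih =>
    rw [pow_succ, ih, Ideal.span_mul_span']
    congr 1
    ext f
    simp only [Set.mem_mul, Set.mem_image, Set.mem_ofPred_eq]
    constructor
    · rintro ⟨_, ⟨_, ⟨g, hg, rfl⟩, rfl⟩, _, ⟨b, hb, rfl⟩, rfl⟩
      refine ⟨_, ⟨Fin.snoc g b, fun j => ?_, rfl⟩, ?_⟩
      · refine Fin.lastCases ?_ (fun j => ?_) j
        · simpa using hb
        · simpa using hg j
      · simp [Fin.sum_univ_castSucc, monomial_mul]
    · rintro ⟨_, ⟨g, hg, rfl⟩, rfl⟩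
      refine ⟨_, ⟨_, ⟨fun j => g j.castSucc, fun j => hg _, rfl⟩, rfl⟩, _, ⟨_, hg (Fin.last r), rfl⟩,
        ?_⟩
      simp [Fin.sum_univ_castSucc, monomial_mul]

theorem monomial_mem_span_pow_iff {k : Type*} [Field k] {σ : Type*} {S : Set (σ →₀ ℕ)} {r : ℕ}
    {a : σ →₀ ℕ} :
    monomial a (1 : k) ∈
        Ideal.span ((fun a => (monomial a (1 : k) : MvPolynomial σ k)) '' S) ^ r ↔
      ∃ g : Fin r → σ →₀ ℕ, (∀ j, g j ∈ S) ∧ ∑ j, g j ≤ a := by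
  classical
  rw [span_monomial_pow, mem_ideal_span_monomial_image]
  simp [support_monomial]

/-! ### The containment of symbolic powers in ordinary powers -/

/-- A pigeonhole argument: if at least `r` times as many vectors as coordinates have sum at most
`b`, then `r` times one of them is at most `b`. -/
theorem exists_mul_le_of_sum_le {σ : Type*} {m r : ℕ} (T : Finset σ) (hT : T.Nonempty)
    (hr : 0 < r) (hm : T.card * r ≤ m) (g : Fin m → σ → ℕ) (b : σ → ℕ)
    (h : ∀ i ∈ T, ∑ j, g j i ≤ b i) : ∃ j, ∀ i ∈ T, r * g j i ≤ b i := by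
  classical
  by_contra! H
  choose i hiT hi using H
  obtain ⟨y, hy, hcard⟩ := Finset.exists_le_card_fiber_of_mul_le_card_of_maps_to
    (s := (Finset.univ : Finset (Fin m))) (t := T) (f := i) (n := r)
    (fun j _ => hiT j) hT (by simpa using hm)
  set F : Finset (Fin m) := Finset.univ.filter fun j => i j = y
  have hFne : F.Nonempty := Finset.card_pos.1 (hr.trans_le hcard)
  have h1 : F.card * b y < ∑ j ∈ F, r * g j y := by
    rw [← smul_eq_mul, ← Finset.sum_const]
    refine Finset.sum_lt_sum_of_nonempty hFne fun j hj => ?_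
    have := hi j
    rwa [(Finset.mem_filter.1 hj).2] at this
  rw [← Finset.mul_sum] at h1
  have h2 : ∑ j ∈ F, g j y ≤ b y :=
    (Finset.sum_le_sum_of_subset (Finset.subset_univ F)).trans (h y hy)
  have h3 : r * ∑ j ∈ F, g j y ≤ F.card * b y := Nat.mul_le_mul hcard h2
  omega

/-- An element which lies in `I` locally at every associated prime of `I` lies in `I`. -/
theorem mem_of_forall_associatedPrimes {R : Type*} [CommRing R] [IsNoetherianRing R]
    (I : Ideal R) (x : R) (h : ∀ P ∈ associatedPrimes R (R ⧸ I), ∃ s ∉ P, s * x ∈ I) :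
    x ∈ I := by
  by_contra hx
  obtain ⟨P, hP, hle⟩ := exists_le_isAssociatedPrime_of_isNoetherianRing R
    (Ideal.Quotient.mk I x) fun h0 => hx (Ideal.Quotient.eq_zero_iff_mem.1 h0)
  obtain ⟨s, hs, hsx⟩ := h P hP
  refine hs (hle ?_)
  have : Ideal.Quotient.mk I (s * x) = 0 := Ideal.Quotient.eq_zero_iff_mem.2 hsx
  simpa [Submodule.mem_colon_singleton, Algebra.smul_def] using this

/-- Membership of a monomial in the power `r` of a monomial ideal, from local membership in the
power `m ≥ e * r` at all associated primes, where `e` bounds the heights of these primes. -/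
theorem monomial_mem_pow_of_local {k : Type*} [Field k] {σ : Type*} [Fintype σ]
    {S : Set (σ →₀ ℕ)} (hS : S.Nonempty) {I : Ideal (MvPolynomial σ k)}
    (hI : I = Ideal.span ((fun a => (monomial a (1 : k) : MvPolynomial σ k)) '' S))
    {e r m : ℕ} (he : ∀ P, ∀ h : P ∈ associatedPrimes (MvPolynomial σ k) (MvPolynomial σ k ⧸ I),
      primeHeight P h.isPrime ≤ (e : ℕ∞)) (hm : e * r ≤ m) {a : σ →₀ ℕ}
    (ha : ∀ P ∈ associatedPrimes (MvPolynomial σ k) (MvPolynomial σ k ⧸ I), ∃ w : σ →₀ ℕ,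
      (∀ i, (X i : MvPolynomial σ k) ∈ P → w i = 0) ∧ monomial (w + a) (1 : k) ∈ I ^ m) :
    monomial a (1 : k) ∈ I ^ r := by
  classical
  rcases Nat.eq_zero_or_pos r with rfl | hr
  · simp [Ideal.one_eq_top]
  let b : σ →₀ ℕ := Finsupp.equivFunOnFinite.symm fun i => a i / r
  have hb : monomial b (1 : k) ∈ I := by
    refine mem_of_forall_associatedPrimes I _ fun P hP => ?_
    have hPp := hP.isPrime
    obtain ⟨w, hw, hwa⟩ := ha P hP
    rw [hI, monomial_mem_span_pow_iff] at hwa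
    obtain ⟨g, hgS, hg⟩ := hwa
    let T : Finset σ := Finset.univ.filter fun i => (X i : MvPolynomial σ k) ∈ P
    have hmemT (i : σ) : i ∈ T ↔ (X i : MvPolynomial σ k) ∈ P := by simp [T]
    have hcard : T.card ≤ e := by
      exact_mod_cast (card_le_primeHeight T P hPp fun i hi => (hmemT i).1 hi).trans (he P hP)
    obtain ⟨c, hcS, hc⟩ : ∃ c ∈ S, ∀ i ∈ T, r * c i ≤ a i := by
      rcases T.eq_empty_or_nonempty with hT | hT
      · obtain ⟨c, hc⟩ := hS
        exact ⟨c, hc, by simp [hT]⟩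
      · obtain ⟨j, hj⟩ := exists_mul_le_of_sum_le T hT hr
          ((Nat.mul_le_mul_right r hcard).trans hm) (fun j => g j) a fun i hi => by
            have := hg i
            rwa [Finsupp.add_apply, hw i ((hmemT i).1 hi), zero_add,
              Finsupp.finsetSum_apply] at this
        exact ⟨g j, hgS j, hj⟩
    let v : σ →₀ ℕ := c.filter fun i => i ∉ T
    refine ⟨monomial v 1, monomial_notMem_of_disjoint hPp fun i hi => ?_, ?_⟩
    · exact Finsupp.filter_apply_neg _ _ (by simpa using (hmemT i).2 hi)
    · rw [monomial_mul, one_mul]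
      refine monomial_mem_of_le (a := c) (fun i => ?_)
        (hI ▸ Ideal.subset_span ⟨c, hcS, rfl⟩)
      rw [Finsupp.add_apply]
      by_cases hi : i ∈ T
      · refine le_add_left ?_
        exact (Nat.le_div_iff_mul_le hr).2 (by rw [mul_comm]; exact hc i hi)
      · have hvi : v i = c i := Finsupp.filter_apply_pos (fun i => i ∉ T) c hi
        exact le_add_right hvi.ge
  have hpow : monomial (r • b) (1 : k) ∈ I ^ r := by
    have := Ideal.pow_mem_pow hb r
    rwa [monomial_pow, one_pow] at this
  refine monomial_mem_of_le (fun i => ?_) hpow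
  exact Nat.mul_div_le (a i) r

/-! ### The symbolic polyhedron and degrees -/

/-- A vector in `ℕ^{n+1}` which is at least the sum of `m > 0` exponent vectors of monomials of
`J` is, after division by `m`, in the convex hull of the lattice points of `J`. -/
theorem smul_expVec_mem_convexHull {k : Type*} [Field k] {n : ℕ}
    {J : Ideal (MvPolynomial (Fin (n + 1)) k)} {m : ℕ} (hm : 0 < m)
    (g : Fin m → Fin (n + 1) →₀ ℕ) (hg : ∀ j, monomial (g j) (1 : k) ∈ J)
    {a : Fin (n + 1) →₀ ℕ} (ha : ∑ j, g j ≤ a) :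
    (m : ℝ)⁻¹ • expVec a ∈ convexHull ℝ (latticePoints J) := by
  classical
  let h : Fin m → Fin (n + 1) →₀ ℕ :=
    fun j => g j + if j = ⟨0, hm⟩ then a - ∑ j, g j else 0
  have hsum : ∑ j, h j = a := by
    simp only [h, Finset.sum_add_distrib, Finset.sum_ite_eq', Finset.mem_univ, if_true]
    exact add_tsub_cancel_of_le ha
  have hm' : (m : ℝ) ≠ 0 := by exact_mod_cast hm.ne'
  have hexp : (m : ℝ)⁻¹ • expVec a = ∑ j : Fin m, (m : ℝ)⁻¹ • expVec (h j) := by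
    rw [← Finset.smul_sum, ← hsum]
    congr 1
    ext i
    simp [expVec, Finset.sum_apply, Finsupp.finsetSum_apply]
  rw [hexp]
  refine (convex_convexHull ℝ _).sum_mem (fun _ _ => by positivity) (by simp [hm'])
    fun j _ => subset_convexHull ℝ _ ⟨h j, monomial_mem_of_le ?_ (hg j), rfl⟩
  exact le_self_add

/-- No boundedness of `Q` is needed, since the infimum of an unbounded set of reals is `0`. -/
theorem alphaSet_le_sum {n : ℕ} {Q : Set (Fin (n + 1) → ℝ)} {v : Fin (n + 1) → ℝ} (hv : v ∈ Q)
    (h0 : 0 ≤ ∑ i, v i) : alphaSet Q ≤ ∑ i, v i := by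
  by_cases hQ : BddBelow ((fun v : Fin (n + 1) → ℝ => ∑ i, v i) '' Q)
  · exact csInf_le hQ ⟨v, hv, rfl⟩
  · rw [alphaSet, Real.sInf_of_not_bddBelow hQ]
    exact h0

theorem smul_expVec_mem_symbolicPolyhedron {k : Type*} [Field k] {n : ℕ}
    {S : Set (Fin (n + 1) →₀ ℕ)} {I : Ideal (MvPolynomial (Fin (n + 1)) k)}
    (hI : I = Ideal.span
      ((fun a => (monomial a (1 : k) : MvPolynomial (Fin (n + 1)) k)) '' S))
    {m : ℕ} (hm : 0 < m) {a : Fin (n + 1) →₀ ℕ}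
    (ha : ∀ P ∈ associatedPrimes (MvPolynomial (Fin (n + 1)) k)
        (MvPolynomial (Fin (n + 1)) k ⧸ I), ∃ w : Fin (n + 1) →₀ ℕ,
      (∀ i, (X i : MvPolynomial (Fin (n + 1)) k) ∈ P → w i = 0) ∧
        monomial (w + a) (1 : k) ∈ I ^ m) :
    (m : ℝ)⁻¹ • expVec a ∈ symbolicPolyhedron I := by
  classical
  refine Set.mem_iInter.2 fun ⟨P, hP⟩ => ?_
  obtain ⟨w, hw, hwa⟩ := ha P hP.1
  rw [hI, monomial_mem_span_pow_iff] at hwa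
  obtain ⟨g, hgS, hg⟩ := hwa
  let p : Fin (n + 1) → Prop := fun i => (X i : MvPolynomial (Fin (n + 1)) k) ∈ P
  refine smul_expVec_mem_convexHull hm (fun j => (g j).filter p) (fun j => ?_) fun i => ?_
  · rw [mem_Qsub_iff]
    refine ⟨monomial ((g j).filter fun i => ¬ p i) 1,
      monomial_notMem_of_disjoint hP.1.isPrime fun i hi =>
        Finsupp.filter_apply_neg _ _ (not_not.2 hi), ?_⟩
    rw [monomial_mul, one_mul, add_comm (Finsupp.filter _ _), Finsupp.filter_add_filter_not, hI]
    exact Ideal.subset_span ⟨g j, hgS j, rfl⟩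
  · rw [Finsupp.finsetSum_apply]
    by_cases hi : p i
    · have := hg i
      rw [Finsupp.add_apply, hw i hi, zero_add, Finsupp.finsetSum_apply] at this
      simpa [Finsupp.filter_apply, hi] using this
    · simp [hi]

/-- Each monomial in `J` is divisible by one of degree at most `β(J)` in `J`. -/
theorem exists_le_sum_le_betaI {k : Type*} [Field k] {n : ℕ}
    {J : Ideal (MvPolynomial (Fin (n + 1)) k)} {a : Fin (n + 1) →₀ ℕ}
    (ha : monomial a (1 : k) ∈ J) :
    ∃ g ≤ a, monomial g (1 : k) ∈ J ∧ ∑ i, g i ≤ betaI J := by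
  obtain ⟨g, hga, hg⟩ := exists_minimal_le_of_wellFoundedLT
    (fun b : Fin (n + 1) →₀ ℕ => monomial b (1 : k) ∈ J) a ha
  have hfin : (minGens J).Finite := by
    refine IsAntichain.finite_of_wellQuasiOrdered (r := (· ≤ ·)) ?_ wellQuasiOrdered_le
    exact fun b hb c hc hne hbc => hne (hc.2 b hb.1 hbc)
  have hgmin : g ∈ minGens J := ⟨hg.prop, fun b hb hbg => le_antisymm hbg (hg.le_of_le hb hbg)⟩
  refine ⟨g, hga, hg.prop, le_csSup ?_ ⟨g, hgmin, rfl⟩⟩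
  exact (hfin.image fun a => ∑ i, a i).bddAbove

theorem symbolic_power_subset_m_pow_mul {k : Type*} [Field k] {n : ℕ}
    (I : Ideal (MvPolynomial (Fin (n + 1)) k)) (hmon : IsMonomialIdeal I) (hI : I ≠ ⊥)
    (e : ℕ) (he : IsBigHeight I e) (r m : ℕ) (hm1 : e * r ≤ m)
    (hm2 : (betaI (I ^ r) : ℝ) ≤ (m : ℝ) * alphaSet (symbolicPolyhedron I)) :
    symbolicPower I m ≤
      mId k n ^ ((⌈alphaSet (symbolicPolyhedron I) * (m : ℝ)⌉ - (betaI (I ^ r) : ℤ)).toNat)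
        * I ^ r := by
  obtain ⟨S, hS⟩ := hmon
  have hSne : S.Nonempty := by
    rw [Set.nonempty_iff_ne_empty]
    rintro rfl
    simp [hS] at hI
  intro f hf
  rw [f.as_sum]
  refine Ideal.sum_mem _ fun a ha => ?_
  have hloc : ∀ P ∈ associatedPrimes (MvPolynomial (Fin (n + 1)) k)
      (MvPolynomial (Fin (n + 1)) k ⧸ I), ∃ w : Fin (n + 1) →₀ ℕ,
      (∀ i, (X i : MvPolynomial (Fin (n + 1)) k) ∈ P → w i = 0) ∧
        monomial (w + a) (1 : k) ∈ I ^ m := by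
    intro P hP
    have hfP : f ∈ Qsub (I ^ m) P hP.isPrime := (Submodule.mem_iInf _).1 hf ⟨P, hP⟩
    obtain ⟨s, hs, hsf⟩ := (mem_Qsub_iff _ _ _ _).1 hfP
    rw [hS, span_monomial_pow] at hsf ⊢
    exact exists_monomial_add_mem hs hsf ha
  obtain ⟨g, hga, hg, hgβ⟩ :=
    exists_le_sum_le_betaI (monomial_mem_pow_of_local hSne hS he.1 hm1 hloc)
  have hdeg : alphaSet (symbolicPolyhedron I) * (m : ℝ) ≤ ((∑ i, a i : ℕ) : ℝ) := by
    rcases Nat.eq_zero_or_pos m with rfl | hm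
    · simpa using Finset.sum_nonneg fun i _ => Nat.cast_nonneg (α := ℝ) (a i)
    · have hsum : ∑ i, ((m : ℝ)⁻¹ • expVec a) i = ((∑ i, a i : ℕ) : ℝ) / m := by
        simp [expVec, ← Finset.mul_sum, div_eq_inv_mul]
      have := alphaSet_le_sum (smul_expVec_mem_symbolicPolyhedron hS hm hloc)
        (by rw [hsum]; positivity)
      rwa [hsum, le_div_iff₀ (by exact_mod_cast hm)] at this
  have hceil : ⌈alphaSet (symbolicPolyhedron I) * (m : ℝ)⌉ ≤ ((∑ i, a i : ℕ) : ℤ) :=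
    Int.ceil_le.2 (by exact_mod_cast hdeg)
  have hsplit : ∑ i, a i = ∑ i, (a - g) i + ∑ i, g i := by
    rw [← Finset.sum_add_distrib]
    refine Finset.sum_congr rfl fun i _ => ?_
    rw [Finsupp.tsub_apply, Nat.sub_add_cancel (hga i)]
  have hcoe : monomial a (coeff a f) = monomial (a - g) (coeff a f) * monomial g (1 : k) := by
    rw [monomial_mul, mul_one, tsub_add_cancel_of_le hga]
  rw [hcoe]
  refine Ideal.mul_mem_mul ?_ hg
  change _ ∈ idealOfVars (Fin (n + 1)) k ^ _
  rw [monomial_mem_pow_idealOfVars_iff _ _ (mem_support_iff.1 ha), Finsupp.degree_eq_sum]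
  omega
end
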